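/- Let A and B be real matrices with I rows, A nonzero, and let β ∈ (0,1]. Let q ∈ ℝ^I be a probability distribution satisfying q(i) ≥ β·‖A(i,:)‖₂² / ‖A‖_F² for all i ∈ [I]. If S ~ D(J, q), then E‖Aᵀ B − Aᵀ Sᵀ S B‖_F² ≤ (1/(β J))·‖A‖_F²·‖B‖_F², where the expectation is over the random sampling matrix S. -/

import Mathlib

open Matrix

noncomputable section

/-- Frobenius norm of a real matrix. -/
def frobNorm {m n : Type*} [Fintype m] [Fintype n] (M : Matrix m n ℝ) : ℝ :=
  Real.sqrt (∑ i, ∑ j, (M i j) ^ 2)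

/-- The sampling matrix determined by the probability vector `q` and the realization
`v` of the sample vector: its `j`-th row is `e_{v(j)}ᵀ / √(J q(v(j)))`. -/
def samplingMatrix {ι : Type*} [DecidableEq ι] {J : ℕ} (q : ι → ℝ) (v : Fin J → ι) :
    Matrix (Fin J) ι ℝ :=
  fun j i => (if i = v j then 1 else 0) / Real.sqrt (J * q (v j))

/-- Summing over samples of length `n + 1` by splitting off the first draw. -/
theorem sum_fin_succ_pi {ι : Type*} [Fintype ι] {n : ℕ} (F : (Fin (n + 1) → ι) → ℝ) :
    ∑ v, F v = ∑ i, ∑ w : Fin n → ι, F (Fin.cons i w) := by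
  rw [← Fintype.sum_prod_type']
  exact (Fintype.sum_equiv (Fin.consEquiv fun _ => ι) _ _ fun _ => rfl).symm

theorem sum_prod_weights {ι : Type*} [Fintype ι] (q : ι → ℝ) (hq : ∑ i, q i = 1) (n : ℕ) :
    ∑ v : Fin n → ι, ∏ j, q (v j) = 1 := by
  induction n with
  | zero => simp
  | succ n ih =>
    simp [sum_fin_succ_pi, Fin.prod_univ_succ, ← Finset.mul_sum, ih, hq]

/-- A sum of i.i.d. centered draws is centered. -/
theorem sum_prod_weights_mul_sum {ι : Type*} [Fintype ι] (q g : ι → ℝ) (hq : ∑ i, q i = 1)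
    (hg : ∑ i, q i * g i = 0) (n : ℕ) :
    ∑ v : Fin n → ι, (∏ j, q (v j)) * ∑ j, g (v j) = 0 := by
  induction n with
  | zero => simp
  | succ n ih =>
    have key (i : ι) : ∑ w : Fin n → ι, (q i * ∏ j, q (w j)) * (g i + ∑ j, g (w j)) =
        q i * g i := by
      calc _ = ∑ w : Fin n → ι, (q i * g i * (∏ j, q (w j)) +
            q i * ((∏ j, q (w j)) * ∑ j, g (w j))) := by
            refine Finset.sum_congr rfl fun w _ => ?_
            ring
        _ = _ := by
            rw [Finset.sum_add_distrib, ← Finset.mul_sum, ← Finset.mul_sum, ih,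
              sum_prod_weights q hq]
            ring
    simp [sum_fin_succ_pi, Fin.prod_univ_succ, Fin.sum_univ_succ, key, hg]

/-- The variance of a sum of i.i.d. centered draws is additive. -/
theorem sum_prod_weights_mul_sum_sq {ι : Type*} [Fintype ι] (q g : ι → ℝ)
    (hq : ∑ i, q i = 1) (hg : ∑ i, q i * g i = 0) (n : ℕ) :
    ∑ v : Fin n → ι, (∏ j, q (v j)) * (∑ j, g (v j)) ^ 2 = n * ∑ i, q i * g i ^ 2 := by
  induction n with
  | zero => simp
  | succ n ih =>
    have key (i : ι) : ∑ w : Fin n → ι, (q i * ∏ j, q (w j)) * (g i + ∑ j, g (w j)) ^ 2 =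
        q i * g i ^ 2 + q i * (n * ∑ i, q i * g i ^ 2) := by
      calc _ = ∑ w : Fin n → ι, (q i * g i ^ 2 * (∏ j, q (w j)) +
            2 * q i * g i * ((∏ j, q (w j)) * ∑ j, g (w j)) +
            q i * ((∏ j, q (w j)) * (∑ j, g (w j)) ^ 2)) := by
            refine Finset.sum_congr rfl fun w _ => ?_
            ring
        _ = _ := by
            rw [Finset.sum_add_distrib, Finset.sum_add_distrib, ← Finset.mul_sum,
              ← Finset.mul_sum, ← Finset.mul_sum, ih, sum_prod_weights q hq,
              sum_prod_weights_mul_sum q g hq hg]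
            ring
    simp only [sum_fin_succ_pi, Fin.prod_univ_succ, Fin.sum_univ_succ, Fin.cons_zero,
      Fin.cons_succ, key]
    rw [Finset.sum_add_distrib, ← Finset.sum_mul, hq]
    push_cast
    ring

/-- The mean squared error of an empirical mean is at most the second moment over the
sample size. -/
theorem sum_prod_weights_mul_mean_error_sq_le {ι : Type*} [Fintype ι] (q f : ι → ℝ)
    (hq : ∑ i, q i = 1) {n : ℕ} (hn : 0 < n) :
    ∑ v : Fin n → ι, (∏ j, q (v j)) * ((∑ i, q i * f i) - (∑ j, f (v j)) / n) ^ 2 ≤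
      (∑ i, q i * f i ^ 2) / n := by
  have hn' : (0 : ℝ) < n := by exact_mod_cast hn
  set m := ∑ i, q i * f i with hm
  have hg : ∑ i, q i * (f i - m) = 0 := by
    simp [mul_sub, Finset.sum_sub_distrib, ← Finset.sum_mul, hq, ← hm]
  have hvar : ∑ i, q i * (f i - m) ^ 2 = ∑ i, q i * f i ^ 2 - m ^ 2 := by
    calc _ = ∑ i, (q i * f i ^ 2 - 2 * m * (q i * f i) + m ^ 2 * q i) := by
          refine Finset.sum_congr rfl fun i _ => ?_
          ring
      _ = _ := by
          rw [Finset.sum_add_distrib, Finset.sum_sub_distrib, ← Finset.mul_sum,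
            ← Finset.mul_sum, hq, ← hm]
          ring
  calc _ = (∑ v : Fin n → ι, (∏ j, q (v j)) * (∑ j, (f (v j) - m)) ^ 2) / n ^ 2 := by
        rw [Finset.sum_div]
        refine Finset.sum_congr rfl fun v _ => ?_
        rw [Finset.sum_sub_distrib, Finset.sum_const, Finset.card_univ, Fintype.card_fin,
          nsmul_eq_mul]
        field_simp
        ring
    _ = (∑ i, q i * f i ^ 2 - m ^ 2) / n := by
        rw [sum_prod_weights_mul_sum_sq q _ hq hg, hvar]
        field_simp
    _ ≤ _ := by
        gcongr
        linarith [sq_nonneg m]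

theorem frobNorm_sq {m n : Type*} [Fintype m] [Fintype n] (M : Matrix m n ℝ) :
    frobNorm M ^ 2 = ∑ i, ∑ j, M i j ^ 2 :=
  Real.sq_sqrt (by positivity)

theorem frobNorm_sq_pos {m n : Type*} [Fintype m] [Fintype n] {M : Matrix m n ℝ}
    (hM : M ≠ 0) : 0 < frobNorm M ^ 2 := by
  obtain ⟨i, j, hij⟩ : ∃ i j, M i j ≠ 0 := by
    by_contra! h
    exact hM (Matrix.ext h)
  rw [frobNorm_sq]
  exact Finset.sum_pos' (fun _ _ => by positivity) ⟨i, Finset.mem_univ _,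
    Finset.sum_pos' (fun _ _ => by positivity) ⟨j, Finset.mem_univ _, by positivity⟩⟩

theorem samplingMatrix_mul_apply {ι κ : Type*} [Fintype ι] [DecidableEq ι] {J : ℕ}
    (q : ι → ℝ) (v : Fin J → ι) (B : Matrix ι κ ℝ) (j : Fin J) (c : κ) :
    (samplingMatrix q v * B) j c = B (v j) c / Real.sqrt (J * q (v j)) := by
  simp [Matrix.mul_apply, samplingMatrix, div_mul_eq_mul_div, ← Finset.sum_div]

/-- The sampled product is an empirical mean of reweighted rank-one terms. -/
theorem sampled_mul_apply {ι κ μ : Type*} [Fintype ι] [DecidableEq ι] {J : ℕ} {q : ι → ℝ}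
    (hq : ∀ i, 0 ≤ q i) (v : Fin J → ι) (A : Matrix ι μ ℝ) (B : Matrix ι κ ℝ)
    (r : μ) (c : κ) :
    (Aᵀ * (samplingMatrix q v)ᵀ * (samplingMatrix q v * B)) r c =
      (∑ j, A (v j) r * B (v j) c / q (v j)) / J := by
  rw [← Matrix.transpose_mul, Matrix.mul_apply, Finset.sum_div]
  refine Finset.sum_congr rfl fun j _ => ?_
  rw [Matrix.transpose_apply, samplingMatrix_mul_apply, samplingMatrix_mul_apply,
    div_mul_div_comm, Real.mul_self_sqrt (mul_nonneg (Nat.cast_nonneg J) (hq _)), div_div,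
    mul_comm (q _)]

/-- Approximate matrix multiplication (Lemma 6 / Drineas–Kannan–Mahoney): if the sampling
distribution `q` satisfies `q(i) ≥ β ‖A(i,:)‖₂² / ‖A‖_F²` for all rows `i`, then for
`S ~ D(J, q)` the expected squared Frobenius error of `Aᵀ Sᵀ S B` as an approximation of
`Aᵀ B` is at most `‖A‖_F² ‖B‖_F² / (β J)`.  The expectation over the i.i.d. sample vector
`v` is written as a sum weighted by the product probabilities `∏ j, q (v j)`. -/
theorem approximate_matrix_multiplication {Id J RA RB : ℕ} (hJ : 0 < J)
    (A : Matrix (Fin Id) (Fin RA) ℝ) (B : Matrix (Fin Id) (Fin RB) ℝ) (hA : A ≠ 0)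
    (β : ℝ) (hβ : β ∈ Set.Ioc (0 : ℝ) 1)
    (q : Fin Id → ℝ) (hq0 : ∀ i, 0 ≤ q i) (hq1 : ∑ i, q i = 1)
    (hq : ∀ i, q i ≥ β * (∑ r, (A i r) ^ 2) / frobNorm A ^ 2) :
    ∑ v : Fin J → Fin Id, (∏ j, q (v j)) *
        frobNorm (Aᵀ * B - Aᵀ * (samplingMatrix q v)ᵀ * (samplingMatrix q v * B)) ^ 2 ≤
      1 / (β * J) * (frobNorm A ^ 2 * frobNorm B ^ 2) := by
  obtain ⟨hβ0, -⟩ := hβ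
  have hA0 := frobNorm_sq_pos hA
  have hJ' : (0 : ℝ) < J := by exact_mod_cast hJ
  have hrow (i : Fin Id) : ∑ r, A i r ^ 2 ≤ q i * (frobNorm A ^ 2 / β) := by
    have h := hq i
    rw [ge_iff_le, div_le_iff₀ hA0] at h
    rw [← mul_div_assoc, le_div_iff₀ hβ0]
    linarith
  have hzero (i : Fin Id) (hi : q i = 0) (r : Fin RA) : A i r = 0 := by
    have h := hrow i
    rw [hi, zero_mul] at h
    have h' := Finset.single_le_sum (f := fun r => A i r ^ 2) (fun _ _ => sq_nonneg _)
      (Finset.mem_univ r)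
    exact pow_eq_zero_iff two_ne_zero |>.mp (le_antisymm (h'.trans h) (sq_nonneg _))
  have hmean (r : Fin RA) (c : Fin RB) :
      (Aᵀ * B) r c = ∑ i, q i * (A i r * B i c / q i) := by
    rw [Matrix.mul_apply]
    refine Finset.sum_congr rfl fun i _ => ?_
    rw [Matrix.transpose_apply]
    by_cases hi : q i = 0
    · simp [hzero i hi r]
    · field_simp
  have hmoment (i : Fin Id) : ∑ r, ∑ c, q i * (A i r * B i c / q i) ^ 2 ≤
      frobNorm A ^ 2 / β * ∑ c, B i c ^ 2 := by
    rcases (hq0 i).eq_or_lt with hi | hi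
    · simp only [← hi, zero_mul, Finset.sum_const_zero]
      positivity
    · calc _ = (∑ r, A i r ^ 2) / q i * ∑ c, B i c ^ 2 := by
            rw [Finset.sum_div, Finset.sum_mul_sum]
            refine Finset.sum_congr rfl fun r _ => Finset.sum_congr rfl fun c _ => ?_
            field_simp
        _ ≤ _ := by
            refine mul_le_mul_of_nonneg_right ?_ (Finset.sum_nonneg fun _ _ => sq_nonneg _)
            rw [div_le_iff₀ hi, mul_comm]
            exact hrow i
  calc _ = ∑ r, ∑ c, ∑ v : Fin J → Fin Id, (∏ j, q (v j)) *
        ((∑ i, q i * (A i r * B i c / q i)) -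
          (∑ j, A (v j) r * B (v j) c / q (v j)) / J) ^ 2 := by
        simp only [frobNorm_sq (_ - _), Matrix.sub_apply, sampled_mul_apply hq0, hmean,
          Finset.mul_sum]
        rw [Finset.sum_comm]
        exact Finset.sum_congr rfl fun r _ => Finset.sum_comm
    _ ≤ ∑ r, ∑ c, (∑ i, q i * (A i r * B i c / q i) ^ 2) / J :=
        Finset.sum_le_sum fun r _ => Finset.sum_le_sum fun c _ =>
          sum_prod_weights_mul_mean_error_sq_le q (fun i => A i r * B i c / q i) hq1 hJ
    _ = (∑ i, ∑ r, ∑ c, q i * (A i r * B i c / q i) ^ 2) / J := by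
        simp only [← Finset.sum_div]
        rw [Finset.sum_comm (s := (Finset.univ : Finset (Fin Id)))]
        congr 1
        exact Finset.sum_congr rfl fun r _ => Finset.sum_comm
    _ ≤ (∑ i, frobNorm A ^ 2 / β * ∑ c, B i c ^ 2) / J := by
        gcongr with i
        exact hmoment i
    _ = _ := by
        rw [← Finset.mul_sum, ← frobNorm_sq B]
        field_simp

end
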